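/- Fix r ∈ (0,1), γ ∈ (0, 2^{−1/(1−r)}), an integer d ≥ γ^{−2−2r/5}, and set η = γ^{1−r}. Then there exist constants C, c > 0 depending only on r and probability distributions P_1 and P_{−1} on {−1,1}^d such that: (i) d_TV(P_1, −P_{−1}) ≤ Cη, where −P_{−1} denotes the pushforward of P_{−1} under the map x ↦ −x and d_TV is the total variation distance; (ii) every x in the support of P_1 satisfies (1/d) Σ_{i=1}^d x_i ≥ Cγ; (iii) for every subset S ⊆ {1,…,d}, |P̂_1(S) − P̂_{−1}(S)| ≤ exp(−c γ^{−2r/5}). -/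

import Mathlib

open MeasureTheory

/-- The Boolean cube `{-1,1}^d` inside `Fin d → ℝ`. -/
def cube (d : ℕ) : Set (Fin d → ℝ) := {x | ∀ i, x i = 1 ∨ x i = -1}

/-- The Fourier coefficient `D̂(S) = E_{x∼D}[∏_{i∈S} x_i]` of a distribution on `{-1,1}^d`. -/
noncomputable def cubeFourier {d : ℕ} (D : Measure (Fin d → ℝ)) (S : Finset (Fin d)) : ℝ :=
  ∫ x, ∏ i ∈ S, x i ∂D

/-- The total variation distance between two probability measures. -/
noncomputable def tvDist {X : Type*} [MeasurableSpace X] (P Q : Measure X) : ℝ :=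
  ⨆ s : {s : Set X // MeasurableSet s}, |(P s).toReal - (Q s).toReal|

/-- The point of the cube whose coordinates equal to `1` are exactly those in `T`. -/
def signVec {d : ℕ} (T : Finset (Fin d)) : Fin d → ℝ := fun i => if i ∈ T then 1 else -1

lemma signVec_mem_cube {d : ℕ} (T : Finset (Fin d)) : signVec T ∈ cube d := by
  intro i
  by_cases h : i ∈ T <;> simp [signVec, h]

lemma signVec_compl {d : ℕ} (T : Finset (Fin d)) (i : Fin d) :
    signVec Tᶜ i = -signVec T i := by
  by_cases h : i ∈ T <;> simp [signVec, h]

lemma abs_signVec {d : ℕ} (T : Finset (Fin d)) (i : Fin d) : |signVec T i| = 1 := by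
  by_cases h : i ∈ T <;> simp [signVec, h]

lemma abs_prod_signVec {d : ℕ} (T S : Finset (Fin d)) : |∏ i ∈ S, signVec T i| = 1 := by
  rw [Finset.abs_prod]
  exact Finset.prod_eq_one fun i _ => abs_signVec T i

lemma prod_signVec_compl {d : ℕ} (T S : Finset (Fin d)) :
    ∏ i ∈ S, signVec Tᶜ i = (-1) ^ S.card * ∏ i ∈ S, signVec T i := by
  simp_rw [signVec_compl, Finset.prod_neg]

lemma sum_signVec {d : ℕ} (T : Finset (Fin d)) : ∑ i, signVec T i = 2 * (T.card : ℝ) - d := by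
  have h : ∀ i, signVec T i = 2 * (if i ∈ T then 1 else 0) - 1 := by
    intro i
    by_cases h : i ∈ T <;> simp [signVec, h]; norm_num
  simp [h, Finset.sum_sub_distrib, mul_comm]

lemma sum_comp_compl {d : ℕ} (f : Finset (Fin d) → ℝ) : ∑ T, f Tᶜ = ∑ T, f T :=
  Fintype.sum_equiv (compl_involutive.toPerm) _ _ fun _ => rfl

/-- The discrete measure on the cube with weights `f`. -/
noncomputable def cubeMeasure {d : ℕ} (f : Finset (Fin d) → ℝ) : Measure (Fin d → ℝ) :=
  ∑ T, ENNReal.ofReal (f T) • Measure.dirac (signVec T)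

lemma cubeMeasure_apply {d : ℕ} (f : Finset (Fin d) → ℝ) (s : Set (Fin d → ℝ)) :
    cubeMeasure f s = ∑ T, ENNReal.ofReal (f T) * s.indicator 1 (signVec T) := by
  simp [cubeMeasure, Measure.finsetSum_apply, Measure.dirac_apply]

lemma toReal_cubeMeasure {d : ℕ} {f : Finset (Fin d) → ℝ} (hf : ∀ T, 0 ≤ f T)
    (s : Set (Fin d → ℝ)) :
    (cubeMeasure f s).toReal = ∑ T, f T * s.indicator 1 (signVec T) := by
  rw [cubeMeasure_apply, ENNReal.toReal_sum]
  · refine Finset.sum_congr rfl fun T _ => ?_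
    by_cases h : signVec T ∈ s <;> simp [h, hf T]
  · intro T _
    by_cases h : signVec T ∈ s <;> simp [h]

lemma cubeMeasure_eq_one {d : ℕ} {f : Finset (Fin d) → ℝ} (hf : ∀ T, 0 ≤ f T)
    (h1 : ∑ T, f T = 1) {s : Set (Fin d → ℝ)} (hs : ∀ T : Finset (Fin d), signVec T ∈ s) :
    cubeMeasure f s = 1 := by
  rw [cubeMeasure_apply]
  simp [hs, ← ENNReal.ofReal_sum_of_nonneg fun T _ => hf T, h1]

lemma cubeFourier_cubeMeasure {d : ℕ} {f : Finset (Fin d) → ℝ} (hf : ∀ T, 0 ≤ f T)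
    (S : Finset (Fin d)) :
    cubeFourier (cubeMeasure f) S = ∑ T, f T * ∏ i ∈ S, signVec T i := by
  rw [cubeFourier, cubeMeasure, integral_finsetSum_measure]
  · refine Finset.sum_congr rfl fun T _ => ?_
    rw [integral_smul_measure, integral_dirac, ENNReal.toReal_ofReal (hf T), smul_eq_mul]
  · intro T _
    exact (integrable_dirac (by simp)).smul_measure ENNReal.ofReal_ne_top

lemma tvDist_cubeMeasure_le {d : ℕ} {f g : Finset (Fin d) → ℝ} (hf : ∀ T, 0 ≤ f T)
    (hg : ∀ T, 0 ≤ g T) :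
    tvDist (cubeMeasure f) (Measure.map (fun x i => -x i) (cubeMeasure g)) ≤
      ∑ T, |f T - g Tᶜ| := by
  have : Nonempty {s : Set (Fin d → ℝ) // MeasurableSet s} := ⟨⟨∅, MeasurableSet.empty⟩⟩
  refine ciSup_le fun ⟨s, hs⟩ => ?_
  have hneg : ∀ T : Finset (Fin d), (fun i => -signVec Tᶜ i) = signVec T := fun T => by
    ext i
    rw [signVec_compl, neg_neg]
  have hmap : (Measure.map (fun x i => -x i) (cubeMeasure g) s).toReal =
      ∑ T, g Tᶜ * s.indicator 1 (signVec T) := by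
    rw [Measure.map_apply (by fun_prop) hs, toReal_cubeMeasure hg, ← sum_comp_compl]
    refine Finset.sum_congr rfl fun T _ => ?_
    congr 1
    rw [← hneg T]
    rfl
  rw [hmap, toReal_cubeMeasure hf, ← Finset.sum_sub_distrib]
  refine (Finset.abs_sum_le_sum_abs _ _).trans (Finset.sum_le_sum fun T _ => ?_)
  by_cases h : signVec T ∈ s <;> simp [h]

lemma exists_measures_of_weights {d : ℕ} {f g : Finset (Fin d) → ℝ} (hf : ∀ T, 0 ≤ f T)
    (hg : ∀ T, 0 ≤ g T) (hf1 : ∑ T, f T = 1) (hg1 : ∑ T, g T = 1) {τ μ ε : ℝ}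
    (htv : ∑ T, |f T - g Tᶜ| ≤ τ) (hmean : ∀ T, f T ≠ 0 → μ ≤ (∑ i, signVec T i) / d)
    (hfourier : ∀ S : Finset (Fin d), |∑ T, f T * ∏ i ∈ S, signVec T i -
      ∑ T, g T * ∏ i ∈ S, signVec T i| ≤ ε) :
    ∃ P1 Pm1 : Measure (Fin d → ℝ),
      IsProbabilityMeasure P1 ∧ IsProbabilityMeasure Pm1 ∧
      P1 (cube d) = 1 ∧ Pm1 (cube d) = 1 ∧
      tvDist P1 (Measure.map (fun x i => -x i) Pm1) ≤ τ ∧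
      (∀ x : Fin d → ℝ, P1 {x} ≠ 0 → μ ≤ (∑ i, x i) / d) ∧
      ∀ S : Finset (Fin d), |cubeFourier P1 S - cubeFourier Pm1 S| ≤ ε := by
  refine ⟨cubeMeasure f, cubeMeasure g, ⟨cubeMeasure_eq_one hf hf1 fun _ => trivial⟩,
    ⟨cubeMeasure_eq_one hg hg1 fun _ => trivial⟩, cubeMeasure_eq_one hf hf1 signVec_mem_cube,
    cubeMeasure_eq_one hg hg1 signVec_mem_cube, (tvDist_cubeMeasure_le hf hg).trans htv, ?_, ?_⟩
  · intro x hx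
    rw [cubeMeasure_apply] at hx
    obtain ⟨T, -, hT⟩ := Finset.exists_ne_zero_of_sum_ne_zero hx
    have hTx : signVec T = x := by
      by_contra h
      simp [h] at hT
    rw [← hTx]
    refine hmean T fun h => ?_
    simp [h] at hT
  · intro S
    rw [cubeFourier_cubeMeasure hf, cubeFourier_cubeMeasure hg]
    exact hfourier S

/-- The weights of the product distribution on the cube whose coordinates all have mean `t`. -/
noncomputable def biasWeight {d : ℕ} (t : ℝ) (T : Finset (Fin d)) : ℝ :=
  ∏ i, (1 + t * signVec T i) / 2

lemma biasWeight_nonneg {d : ℕ} {t : ℝ} (h0 : -1 ≤ t) (h1 : t ≤ 1) (T : Finset (Fin d)) :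
    0 ≤ biasWeight t T := by
  refine Finset.prod_nonneg fun i _ => ?_
  by_cases h : i ∈ T <;> simp [signVec, h] <;> linarith

lemma biasWeight_compl {d : ℕ} (t : ℝ) (T : Finset (Fin d)) :
    biasWeight t Tᶜ = biasWeight (-t) T := by
  simp [biasWeight, signVec_compl]

lemma sum_prod_signVec {d : ℕ} (h : Fin d → ℝ → ℝ) :
    ∑ T, ∏ i, h i (signVec T i) = ∏ i, (h i 1 + h i (-1)) := by
  rw [Fintype.prod_add]
  refine Finset.sum_congr rfl fun T _ => ?_
  rw [← Finset.prod_mul_prod_compl T]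
  congr 1
  · exact Finset.prod_congr rfl fun i hi => by simp [signVec, hi]
  · exact Finset.prod_congr rfl fun i hi => by simp [signVec, Finset.mem_compl.mp hi]

lemma biasWeight_fourier {d : ℕ} (t : ℝ) (S : Finset (Fin d)) :
    ∑ T, biasWeight t T * ∏ i ∈ S, signVec T i = t ^ S.card := by
  have h : ∀ T : Finset (Fin d), biasWeight t T * ∏ i ∈ S, signVec T i =
      ∏ i, ((1 + t * signVec T i) / 2 * if i ∈ S then signVec T i else 1) := fun T => by
    rw [Finset.prod_mul_distrib, Finset.prod_ite_mem, Finset.univ_inter, biasWeight]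
  simp_rw [h]
  rw [sum_prod_signVec fun i y => (1 + t * y) / 2 * if i ∈ S then y else 1]
  have h' : ∀ i, ((1 + t * 1) / 2 * (if i ∈ S then (1 : ℝ) else 1) +
      (1 + t * -1) / 2 * if i ∈ S then (-1 : ℝ) else 1) = if i ∈ S then t else 1 := by
    intro i
    split_ifs <;> ring
  simp only [h', Finset.prod_ite_mem, Finset.univ_inter, Finset.prod_const]

lemma sum_biasWeight {d : ℕ} (t : ℝ) : ∑ T : Finset (Fin d), biasWeight t T = 1 := by
  simpa using biasWeight_fourier (d := d) t ∅

lemma cosh_le_one_add_sq {x : ℝ} (hx : x ^ 2 ≤ 1) : Real.cosh x ≤ 1 + x ^ 2 := by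
  have hb := Real.abs_exp_sub_one_sub_id_le (x := x ^ 2 / 2)
    (by rw [abs_of_nonneg (by positivity)]; linarith)
  have := (abs_le.mp hb).2
  have := Real.cosh_le_exp_half_sq x
  nlinarith [mul_nonneg (sq_nonneg x) (sub_nonneg.mpr hx)]

/-- A Chernoff bound for the lower tail of a product distribution with mean at least `s`. -/
lemma biasWeight_tail {d : ℕ} {s t : ℝ} (hs : 0 < s) (hs1 : s ≤ 1) (hst : s ≤ t) (ht : t ≤ 1) :
    ∑ T : Finset (Fin d) with ∑ i, signVec T i < d * (s / 2), biasWeight t T ≤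
      Real.exp (-(d * s ^ 2 / 16)) := by
  set l := s / 4 with hl
  have hfac : Real.cosh l - t * Real.sinh l ≤ Real.exp (l ^ 2 - s * l) := by
    have h1 : Real.cosh l ≤ 1 + l ^ 2 := cosh_le_one_add_sq (by nlinarith)
    have h2 : l ≤ Real.sinh l := Real.self_le_sinh_iff.mpr (by positivity)
    have h3 : s * l ≤ t * Real.sinh l := mul_le_mul hst h2 (by positivity) (by linarith)
    linarith [Real.add_one_le_exp (l ^ 2 - s * l)]
  have hpos : 0 ≤ Real.cosh l - t * Real.sinh l := by
    have : 0 ≤ Real.sinh l := Real.sinh_nonneg_iff.mpr (by positivity)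
    have := Real.sinh_lt_cosh l
    nlinarith
  calc ∑ T : Finset (Fin d) with ∑ i, signVec T i < d * (s / 2), biasWeight t T
      ≤ ∑ T : Finset (Fin d), biasWeight t T *
          Real.exp (l * (d * (s / 2) - ∑ i, signVec T i)) := by
        rw [Finset.sum_filter]
        refine Finset.sum_le_sum fun T _ => ?_
        have hb := biasWeight_nonneg (by linarith : -1 ≤ t) ht T
        split_ifs with h
        · refine le_mul_of_one_le_right hb (Real.one_le_exp ?_)
          exact mul_nonneg (by positivity) (by linarith)
        · positivity
    _ = Real.exp (l * (d * (s / 2))) * ∑ T : Finset (Fin d),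
          ∏ i, ((1 + t * signVec T i) / 2 * Real.exp (-l * signVec T i)) := by
        rw [Finset.mul_sum]
        refine Finset.sum_congr rfl fun T _ => ?_
        rw [Finset.prod_mul_distrib, ← Real.exp_sum, ← Finset.mul_sum, mul_sub, sub_eq_add_neg,
          Real.exp_add, biasWeight, neg_mul]
        ring
    _ = Real.exp (l * (d * (s / 2))) * (Real.cosh l - t * Real.sinh l) ^ d := by
        rw [sum_prod_signVec fun _ y => (1 + t * y) / 2 * Real.exp (-l * y)]
        rw [Finset.prod_const, Finset.card_univ, Fintype.card_fin, Real.cosh_eq, Real.sinh_eq]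
        congr 2
        simp only [mul_one, mul_neg, neg_neg]
        ring
    _ ≤ Real.exp (l * (d * (s / 2))) * Real.exp (l ^ 2 - s * l) ^ d := by gcongr
    _ = Real.exp (-(d * s ^ 2 / 16)) := by
        rw [← Real.exp_nat_mul, ← Real.exp_add, hl]
        ring_nf

lemma eval_chebyshev_T_le {n : ℕ} {e : ℝ} (he : 0 ≤ e) (hne : 2 * n ^ 2 * e ≤ 1) :
    (Polynomial.Chebyshev.T ℝ n).eval (1 + e) ≤ 1 + 2 * n ^ 2 * e := by
  set u := Real.arcosh (1 + e)
  have hu : Real.cosh u = 1 + e := Real.cosh_arcosh (by linarith)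
  have hu0 : 0 ≤ u := Real.arcosh_nonneg (by linarith)
  have hue : u ^ 2 ≤ 2 * e := by
    have h1 : u / 2 ≤ Real.sinh (u / 2) := Real.self_le_sinh_iff.mpr (by positivity)
    have h2 := Real.cosh_two_mul (u / 2)
    rw [mul_div_cancel₀ u two_ne_zero, Real.cosh_sq, hu] at h2
    nlinarith [pow_le_pow_left₀ (by positivity) h1 2]
  have hnu : (n * u) ^ 2 ≤ 2 * n ^ 2 * e := by
    nlinarith [mul_le_mul_of_nonneg_left hue (sq_nonneg (n : ℝ))]
  rw [← hu, Polynomial.Chebyshev.T_real_cosh, Int.cast_natCast]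
  linarith [cosh_le_one_add_sq (hnu.trans hne)]

open Polynomial.Chebyshev in
/-- Extrapolation from `[-1, 1]` to a point slightly to the right of `1` is exact on polynomials of
degree at most `n` for a functional that is close to evaluation at `1`. -/
lemma exists_extrapolation (n : ℕ) {e : ℝ} (he : 0 ≤ e) (hne : 2 * n ^ 2 * e ≤ 1) :
    ∃ L v : ℕ → ℝ, v 0 = 1 ∧ (∀ m, v m ∈ Set.Icc (-1) 1) ∧
      (∀ P : Polynomial ℝ, P.degree ≤ n →
        ∑ m ∈ Finset.range (n + 1), L m * P.eval (v m) = P.eval (1 + e)) ∧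
      1 ≤ L 0 ∧ ∑ m ∈ Finset.range (n + 1), |L m| ≤ 1 + 2 * n ^ 2 * e := by
  set L : ℕ → ℝ := fun m => (Lagrange.basis (Finset.range (n + 1)) (node n) m).eval (1 + e)
  have hL : ∀ m, L m = (∏ j ∈ (Finset.range (n + 1)).erase m, (node n m - node n j))⁻¹ *
      ∏ j ∈ (Finset.range (n + 1)).erase m, (1 + e - node n j) := fun m => by
    simp only [L, Lagrange.basis, Lagrange.basisDivisor, Polynomial.eval_prod,
      Polynomial.eval_mul, Polynomial.eval_C, Polynomial.eval_sub, Polynomial.eval_X,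
      Finset.prod_mul_distrib, Finset.prod_inv_distrib]
  have hnode : ∀ j, node n j ≤ 1 := fun j => node_mem_Icc.2
  have hexact : ∀ P : Polynomial ℝ, P.degree ≤ n →
      ∑ m ∈ Finset.range (n + 1), L m * P.eval (node n m) = P.eval (1 + e) := by
    intro P hP
    have hdeg : P.degree < (Finset.range (n + 1)).card := by
      rw [Finset.card_range]
      exact hP.trans_lt (by exact_mod_cast n.lt_succ_self)
    conv_rhs => rw [Lagrange.eq_interpolate (strictAntiOn_node n).injOn hdeg]
    rw [Lagrange.interpolate_apply, Polynomial.eval_finsetSum]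
    refine Finset.sum_congr rfl fun m _ => ?_
    rw [Polynomial.eval_mul, Polynomial.eval_C, mul_comm]
  refine ⟨L, node n, node_eq_one, fun m => node_mem_Icc, hexact, ?_, ?_⟩
  · rw [hL, ← Finset.prod_inv_distrib, ← Finset.prod_mul_distrib]
    refine Finset.prod_const_one.symm.le.trans
      (Finset.prod_le_prod (fun _ _ => zero_le_one) fun j hj => ?_)
    have hj' := Finset.mem_erase.mp hj
    have : node n j < node n 0 :=
      node_lt (Finset.mem_range_succ_iff.mp hj'.2) (Nat.pos_of_ne_zero hj'.1)
    rw [node_eq_one] at this ⊢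
    rw [inv_mul_eq_div, le_div_iff₀ (by linarith)]
    linarith
  · have habs : ∀ m ∈ Finset.range (n + 1), |L m| = L m * (T ℝ n).eval (node n m) := by
      intro m hm
      have hm' : m ≤ n := Finset.mem_range_succ_iff.mp hm
      rw [eval_T_real_node (Finset.mem_Iic.mpr hm')]
      have h1 := zero_lt_prod_node_sub_node hm'
      have h2 : 0 ≤ L m * (-1) ^ m := by
        have h3 : ((-1 : ℝ) ^ m)⁻¹ = (-1) ^ m := by rw [← inv_pow, inv_neg, inv_one]
        have h4 : 0 ≤ ∏ j ∈ (Finset.range (n + 1)).erase m, (1 + e - node n j) :=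
          Finset.prod_nonneg fun j _ => by linarith [hnode j]
        have h5 := mul_nonneg (inv_nonneg.mpr h1.le) h4
        rw [mul_inv, h3] at h5
        rw [hL]
        linarith
      rw [← abs_of_nonneg h2, abs_mul, abs_neg_one_pow, mul_one]
    rw [Finset.sum_congr rfl habs, hexact _ (by simp [degree_T])]
    exact eval_chebyshev_T_le he hne

/-- Two distributions on the cube, one of which has a large mean and is close to the reflection of
the other, whose Fourier coefficients of degree at most `n` agree. -/
lemma exists_matching_weights (d n : ℕ) {s : ℝ} (hs : 0 < s) (hs8 : s ≤ 1 / 8)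
    (hsn : 64 * s * n ^ 2 ≤ 1) :
    ∃ A B : Finset (Fin d) → ℝ, (∀ T, 0 ≤ A T) ∧ (∀ T, 0 ≤ B T) ∧ ∑ T, A T = 1 ∧ ∑ T, B T = 1 ∧
      ∑ T, |A T - B Tᶜ| ≤ 64 * s * n ^ 2 ∧
      ∑ T with ∑ i, signVec T i < d * (s / 2), A T ≤ Real.exp (-(d * s ^ 2 / 16)) ∧
      ∀ S : Finset (Fin d), |∑ T, A T * ∏ i ∈ S, signVec T i - ∑ T, B T * ∏ i ∈ S, signVec T i| ≤
        2 * (1 / 4) ^ (n + 1) := by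
  obtain ⟨L, v, hv0, hv, hexact, hL0, hLabs⟩ :=
    exists_extrapolation n (e := 32 * s) (by positivity) (by linarith)
  set R := Finset.range (n + 1) with hR
  set t : ℕ → ℝ := fun m => s + (1 - v m) / 16 with ht
  have hts : ∀ m, s ≤ t m := fun m => by
    simp only [ht]
    linarith [(hv m).2]
  have ht4 : ∀ m, t m ≤ 1 / 4 := fun m => by
    simp only [ht]
    linarith [(hv m).1]
  have ht0 : t 0 = s := by simp [ht, hv0]
  have hmom : ∀ k ≤ n, ∑ m ∈ R, L m * t m ^ k = (-s) ^ k := by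
    intro k hk
    have hdeg : ((Polynomial.C s + Polynomial.C (1 / 16) *
        (1 - Polynomial.X)) ^ k : Polynomial ℝ).degree ≤ n := by
      have h1 : (Polynomial.C s + Polynomial.C (1 / 16) * (1 - Polynomial.X)).degree ≤ 1 := by
        compute_degree
      exact (Polynomial.degree_pow_le_of_le k h1).trans (by simpa using hk)
    have h := hexact _ hdeg
    simp only [Polynomial.eval_pow, Polynomial.eval_add, Polynomial.eval_mul, Polynomial.eval_C,
      Polynomial.eval_sub, Polynomial.eval_one, Polynomial.eval_X] at h
    convert h using 2
    · simp only [ht]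
      ring
    · ring
  have hLsum : ∑ m ∈ R, L m = 1 := by simpa using hmom 0 n.zero_le
  set M : ℝ := ∑ m ∈ R, (L m)⁺ with hM
  have hparts : ∀ m, L m = (L m)⁺ - (L m)⁻ := fun m => (posPart_sub_negPart (L m)).symm
  have hMneg : M = 1 + ∑ m ∈ R, (L m)⁻ := by
    rw [← hLsum, ← Finset.sum_add_distrib]
    exact Finset.sum_congr rfl fun m _ => by linarith [hparts m]
  have hM1 : 1 ≤ M := by
    rw [hMneg]
    linarith [Finset.sum_nonneg fun m (_ : m ∈ R) => negPart_nonneg (L m)]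
  have hM0 : 0 < M := by linarith
  have hbias : ∀ m (T : Finset (Fin d)), 0 ≤ biasWeight (t m) T := fun m T =>
    biasWeight_nonneg (by linarith [hts m]) (by linarith [ht4 m]) T
  have hA : ∀ S : Finset (Fin d), ∑ T, ((∑ m ∈ R, (L m)⁺ * biasWeight (t m) T) / M) *
      ∏ i ∈ S, signVec T i = (∑ m ∈ R, (L m)⁺ * t m ^ S.card) / M := by
    intro S
    simp_rw [div_mul_eq_mul_div, ← Finset.sum_div, Finset.sum_mul, mul_assoc]
    rw [Finset.sum_comm]
    simp_rw [← Finset.mul_sum, biasWeight_fourier]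
  have hB : ∀ S : Finset (Fin d), ∑ T, ((biasWeight (-s) T +
      ∑ m ∈ R, (L m)⁻ * biasWeight (t m) T) / M) * ∏ i ∈ S, signVec T i =
      ((-s) ^ S.card + ∑ m ∈ R, (L m)⁻ * t m ^ S.card) / M := by
    intro S
    simp_rw [div_mul_eq_mul_div, ← Finset.sum_div, add_mul, Finset.sum_mul, mul_assoc]
    rw [Finset.sum_add_distrib, Finset.sum_comm, biasWeight_fourier]
    simp_rw [← Finset.mul_sum, biasWeight_fourier]
  refine ⟨fun T => (∑ m ∈ R, (L m)⁺ * biasWeight (t m) T) / M,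
    fun T => (biasWeight (-s) T + ∑ m ∈ R, (L m)⁻ * biasWeight (t m) T) / M,
    fun T => div_nonneg (Finset.sum_nonneg fun m _ => mul_nonneg (posPart_nonneg _) (hbias m T))
      hM0.le,
    fun T => div_nonneg (add_nonneg (biasWeight_nonneg (by linarith) (by linarith) T)
      (Finset.sum_nonneg fun m _ => mul_nonneg (negPart_nonneg _) (hbias m T))) hM0.le, ?_, ?_,
    ?_, ?_, ?_⟩
  · simpa [← hM, hM0.ne'] using hA ∅
  · simpa [← hMneg, hM0.ne'] using hB ∅
  · have hdecomp : ∀ T : Finset (Fin d), |(∑ m ∈ R, (L m)⁺ * biasWeight (t m) T) / M -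
        (biasWeight (-s) Tᶜ + ∑ m ∈ R, (L m)⁻ * biasWeight (t m) Tᶜ) / M| ≤
        (L 0 - 1) * biasWeight s T + ∑ m ∈ R.erase 0,
          ((L m)⁺ * biasWeight (t m) T + (L m)⁻ * biasWeight (-(t m)) T) := by
      intro T
      have h0 : 0 ∈ R := by simp [hR]
      have hneg0 : (L 0)⁻ = 0 := negPart_eq_zero.mpr (by linarith)
      have hpos0 : (L 0)⁺ = L 0 := posPart_eq_self.mpr (by linarith)
      rw [← sub_div, abs_div, abs_of_pos hM0]
      refine (div_le_self (abs_nonneg _) hM1).trans ?_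
      simp_rw [biasWeight_compl]
      rw [neg_neg, ← Finset.add_sum_erase R _ h0, ← Finset.add_sum_erase R _ h0, hneg0, hpos0, ht0]
      have e1 : L 0 * biasWeight s T + ∑ m ∈ R.erase 0, (L m)⁺ * biasWeight (t m) T -
          (biasWeight s T + (0 * biasWeight (-s) T +
            ∑ m ∈ R.erase 0, (L m)⁻ * biasWeight (-(t m)) T)) =
          (L 0 - 1) * biasWeight s T + ∑ m ∈ R.erase 0,
          ((L m)⁺ * biasWeight (t m) T - (L m)⁻ * biasWeight (-(t m)) T) := by
        rw [Finset.sum_sub_distrib]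
        ring
      rw [e1]
      refine (abs_add_le _ _).trans (add_le_add ?_ ?_)
      · rw [abs_of_nonneg (mul_nonneg (by linarith) (biasWeight_nonneg (by linarith)
          (by linarith) T))]
      · refine (Finset.abs_sum_le_sum_abs _ _).trans (Finset.sum_le_sum fun m _ => ?_)
        have h1 := mul_nonneg (posPart_nonneg (L m)) (hbias m T)
        have h2 := mul_nonneg (negPart_nonneg (L m))
          (biasWeight_nonneg (t := -(t m)) (by linarith [ht4 m]) (by linarith [hts m]) T)
        rw [abs_le]
        constructor <;> linarith
    refine (Finset.sum_le_sum fun T _ => hdecomp T).trans ?_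
    rw [Finset.sum_add_distrib, Finset.sum_comm]
    simp_rw [Finset.sum_add_distrib, ← Finset.mul_sum, sum_biasWeight, mul_one]
    rw [← Finset.sum_add_distrib]
    simp_rw [posPart_add_negPart]
    rw [← Finset.add_sum_erase R _ (by simp [hR] : 0 ∈ R)] at hLabs
    linarith [le_abs_self (L 0)]
  · rw [← Finset.sum_div, Finset.sum_comm, div_le_iff₀ hM0]
    simp_rw [← Finset.mul_sum]
    rw [hM, Finset.mul_sum]
    refine Finset.sum_le_sum fun m _ => ?_
    rw [mul_comm (Real.exp _)]
    exact mul_le_mul_of_nonneg_left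
      (biasWeight_tail hs (by linarith) (hts m) (by linarith [ht4 m])) (posPart_nonneg _)
  · intro S
    rw [hA, hB]
    by_cases hS : S.card ≤ n
    · rw [← hmom _ hS, ← sub_div, ← Finset.sum_add_distrib, ← Finset.sum_sub_distrib,
        Finset.sum_eq_zero fun m _ => ?_, zero_div, abs_zero]
      · positivity
      · linear_combination (-(t m ^ S.card)) * hparts m
    · have hpow : ∀ x : ℝ, |x| ≤ 1 / 4 → |x ^ S.card| ≤ (1 / 4) ^ (n + 1) := fun x hx => by
        rw [abs_pow]
        exact (pow_le_pow_left₀ (abs_nonneg x) hx _).trans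
          (pow_le_pow_of_le_one (by norm_num) (by norm_num) (by omega))
      have ht4' : ∀ m, |t m| ≤ 1 / 4 := fun m =>
        abs_le.mpr ⟨by linarith [hts m], ht4 m⟩
      have h1 : |(∑ m ∈ R, (L m)⁺ * t m ^ S.card) / M| ≤ (1 / 4) ^ (n + 1) := by
        rw [abs_div, abs_of_pos hM0, div_le_iff₀ hM0, mul_comm, hM, Finset.sum_mul]
        refine (Finset.abs_sum_le_sum_abs _ _).trans (Finset.sum_le_sum fun m _ => ?_)
        rw [abs_mul, abs_of_nonneg (posPart_nonneg _)]
        exact mul_le_mul_of_nonneg_left (hpow _ (ht4' m)) (posPart_nonneg _)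
      have h2 : |((-s) ^ S.card + ∑ m ∈ R, (L m)⁻ * t m ^ S.card) / M| ≤ (1 / 4) ^ (n + 1) := by
        rw [abs_div, abs_of_pos hM0, div_le_iff₀ hM0, mul_comm, hMneg, add_mul, Finset.sum_mul,
          one_mul]
        refine (abs_add_le _ _).trans (add_le_add
          (hpow _ (by rw [abs_neg, abs_of_pos hs]; linarith)) ?_)
        refine (Finset.abs_sum_le_sum_abs _ _).trans (Finset.sum_le_sum fun m _ => ?_)
        rw [abs_mul, abs_of_nonneg (negPart_nonneg _)]
        exact mul_le_mul_of_nonneg_left (hpow _ (ht4' m)) (negPart_nonneg _)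
      refine (abs_sub _ _).trans ?_
      linarith

lemma exists_measures_of_small_parameter {d n : ℕ} (hd : 0 < d) {s : ℝ} (hs : 0 < s)
    (hs8 : s ≤ 1 / 8) (hsn : 64 * s * n ^ 2 ≤ 1) :
    ∃ P1 Pm1 : Measure (Fin d → ℝ),
      IsProbabilityMeasure P1 ∧ IsProbabilityMeasure Pm1 ∧
      P1 (cube d) = 1 ∧ Pm1 (cube d) = 1 ∧
      tvDist P1 (Measure.map (fun x i => -x i) Pm1) ≤
        64 * s * n ^ 2 + 2 * Real.exp (-(d * s ^ 2 / 16)) ∧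
      (∀ x : Fin d → ℝ, P1 {x} ≠ 0 → s / 2 ≤ (∑ i, x i) / d) ∧
      ∀ S : Finset (Fin d), |cubeFourier P1 S - cubeFourier Pm1 S| ≤
        2 * (1 / 4) ^ (n + 1) + 2 * Real.exp (-(d * s ^ 2 / 16)) := by
  obtain ⟨A, B, hA0, hB0, hA1, hB1, htv, htail, hfourier⟩ :=
    exists_matching_weights d n hs hs8 hsn
  set δ := Real.exp (-(d * s ^ 2 / 16))
  set β := ∑ T with ∑ i, signVec T i < d * (s / 2), A T with hβ
  have hβ0 : 0 ≤ β := Finset.sum_nonneg fun T _ => hA0 T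
  set low : Finset (Fin d) → ℝ := fun T => if ∑ i, signVec T i < d * (s / 2) then A T else 0
    with hlow
  set top : Finset (Fin d) → ℝ := fun T => if T = Finset.univ then β else 0 with htop
  have hlow0 : ∀ T, 0 ≤ low T := fun T => by
    simp only [hlow]
    split_ifs
    exacts [hA0 T, le_rfl]
  have hlowA : ∀ T, low T ≤ A T := fun T => by
    simp only [hlow]
    split_ifs
    exacts [le_rfl, hA0 T]
  have htop0 : ∀ T, 0 ≤ top T := fun T => by
    simp only [htop]
    split_ifs
    exacts [hβ0, le_rfl]
  have hlow_sum : ∑ T, low T = β := (Finset.sum_filter _ _).symm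
  have htop_sum : ∑ T, top T = β := by simp [htop]
  have hdiff : ∀ T, |top T - low T| ≤ top T + low T := fun T =>
    abs_le.mpr ⟨by linarith [htop0 T], by linarith [hlow0 T]⟩
  refine exists_measures_of_weights (f := fun T => A T + (top T - low T)) (g := B)
    (fun T => by linarith [htop0 T, hlowA T]) hB0 ?_ hB1 ?_ ?_ ?_
  · rw [Finset.sum_add_distrib, Finset.sum_sub_distrib, hA1, hlow_sum, htop_sum]
    ring
  · calc ∑ T, |A T + (top T - low T) - B Tᶜ|
        ≤ ∑ T, (|A T - B Tᶜ| + (top T + low T)) := by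
          refine Finset.sum_le_sum fun T _ => ?_
          rw [add_sub_right_comm]
          exact (abs_add_le _ _).trans (by linarith [hdiff T])
      _ ≤ 64 * s * n ^ 2 + 2 * δ := by
          rw [Finset.sum_add_distrib, Finset.sum_add_distrib, hlow_sum, htop_sum]
          linarith
  · intro T hT
    have hd' : (0 : ℝ) < d := Nat.cast_pos.mpr hd
    rw [le_div_iff₀ hd']
    by_contra! h
    have hT' : T ≠ Finset.univ := by
      rintro rfl
      rw [sum_signVec, Finset.card_univ, Fintype.card_fin] at h
      nlinarith
    rw [mul_comm] at h
    simp [hlow, htop, h, hT'] at hT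
  · intro S
    have hsplit : ∑ T, (A T + (top T - low T)) * ∏ i ∈ S, signVec T i -
        ∑ T, B T * ∏ i ∈ S, signVec T i =
        (∑ T, A T * ∏ i ∈ S, signVec T i - ∑ T, B T * ∏ i ∈ S, signVec T i) +
        ∑ T, (top T - low T) * ∏ i ∈ S, signVec T i := by
      simp_rw [add_mul, Finset.sum_add_distrib]
      ring
    rw [hsplit]
    refine (abs_add_le _ _).trans (add_le_add (hfourier S) ?_)
    calc |∑ T, (top T - low T) * ∏ i ∈ S, signVec T i| ≤ ∑ T, (top T + low T) := by
          refine (Finset.abs_sum_le_sum_abs _ _).trans (Finset.sum_le_sum fun T _ => ?_)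
          rw [abs_mul, abs_prod_signVec, mul_one]
          exact hdiff T
      _ ≤ 2 * δ := by
          rw [Finset.sum_add_distrib, hlow_sum, htop_sum]
          linarith

open Filter Topology in
lemma exists_small_threshold {r : ℝ} (hr0 : 0 < r) (b : ℝ) (hb : 0 < b) (q : ℝ) (ε : ℝ)
    (hε : 0 < ε) :
    ∃ γ₀ : ℝ, 0 < γ₀ ∧ γ₀ ≤ 1 ∧ ∀ γ, 0 < γ → γ < γ₀ → γ ^ (r / 5) ≤ ε ∧
      Real.exp (-b * γ ^ (-(2 * r / 5))) ≤ ε * γ ^ q ∧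
      Real.exp (-b * γ ^ (-(2 * r / 5))) ≤ ε := by
  have hΛ : Tendsto (fun γ : ℝ => γ ^ (-(2 * r / 5))) (𝓝[>] 0) atTop :=
    tendsto_rpow_neg_nhdsGT_zero (by linarith)
  have h1 : ∀ᶠ γ : ℝ in 𝓝[>] 0, γ ^ (r / 5) ≤ ε := by
    have : Tendsto (fun γ : ℝ => γ ^ (r / 5)) (𝓝[>] 0) (𝓝 0) := by
      have h := (Real.continuousAt_rpow_const 0 (r / 5) (Or.inr (by positivity))).tendsto
      rw [Real.zero_rpow (by positivity)] at h
      exact h.mono_left nhdsWithin_le_nhds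
    exact (this.eventually (gt_mem_nhds hε)).mono fun _ h => le_of_lt h
  have hexp : ∀ p : ℝ, ∀ᶠ γ : ℝ in 𝓝[>] 0,
      (γ ^ (-(2 * r / 5))) ^ p * Real.exp (-b * γ ^ (-(2 * r / 5))) ≤ ε := fun p =>
    (((tendsto_rpow_mul_exp_neg_mul_atTop_nhds_zero p b hb).comp hΛ).eventually
      (gt_mem_nhds hε)).mono fun _ h => le_of_lt h
  have hall := (h1.and ((hexp (5 * q / (2 * r))).and (hexp 0)))
  obtain ⟨u, hu, hmem⟩ := mem_nhdsGT_iff_exists_Ioo_subset.mp hall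
  refine ⟨min u 1, lt_min hu one_pos, min_le_right _ _, fun γ hγ hγu => ?_⟩
  obtain ⟨g1, g2, g3⟩ := hmem ⟨hγ, hγu.trans_le (min_le_left _ _)⟩
  refine ⟨g1, ?_, by simpa using g3⟩
  rw [← Real.rpow_mul hγ.le, show -(2 * r / 5) * (5 * q / (2 * r)) = -q by field_simp,
    Real.rpow_neg hγ.le, inv_mul_le_iff₀ (by positivity)] at g2
  linarith

lemma card_filter_mem_card_eq {d : ℕ} (i : Fin d) {a : ℕ} (ha : 1 ≤ a) :
    (Finset.univ.filter fun T : Finset (Fin d) => i ∈ T ∧ T.card = a).card =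
      (d - 1).choose (a - 1) := by
  have h : (Finset.powersetCard (a - 1) (Finset.univ.erase i)).card = (d - 1).choose (a - 1) := by
    simp
  rw [← h]
  refine Finset.card_nbij' (fun T => T.erase i) (fun T => insert i T) ?_ ?_ ?_ ?_
  · intro T hT
    have hT' := (Finset.mem_filter.mp hT).2
    simp [Finset.mem_powersetCard, Finset.card_erase_of_mem hT'.1, hT'.2,
      Finset.erase_subset_erase]
  · intro T hT
    obtain ⟨h1, h2⟩ := Finset.mem_powersetCard.mp hT
    have hi : i ∉ T := fun hi => by simpa using h1 hi
    simp only [Finset.coe_filter, Finset.mem_univ, true_and, Set.mem_ofPred_eq,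
      Finset.mem_insert_self, Finset.card_insert_of_notMem hi]
    omega
  · intro T hT
    exact Finset.insert_erase (Finset.mem_filter.mp hT).2.1
  · intro T hT
    have h1 := (Finset.mem_powersetCard.mp hT).1
    exact Finset.erase_insert fun hi => by simpa using h1 hi

lemma prod_signVec_insert {d : ℕ} {S T : Finset (Fin d)} {i : Fin d} (hS : i ∈ S) (hT : i ∉ T) :
    ∏ j ∈ S, signVec (insert i T) j = -∏ j ∈ S, signVec T j := by
  rw [← Finset.mul_prod_erase S _ hS, ← Finset.mul_prod_erase S (signVec T) hS]
  have h : ∏ j ∈ S.erase i, signVec (insert i T) j = ∏ j ∈ S.erase i, signVec T j :=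
    Finset.prod_congr rfl fun j hj => by
      simp [signVec, Finset.mem_insert, Finset.ne_of_mem_erase hj]
  rw [h]
  simp [signVec, hT]

/-- Flipping a coordinate of `S` cancels the character sum over an upper level set of the cube,
except on its boundary in that direction. -/
lemma abs_sum_upper_character_le {d : ℕ} {S : Finset (Fin d)} {i : Fin d} (hS : i ∈ S) {a : ℕ}
    (ha : 1 ≤ a) :
    |∑ T : Finset (Fin d) with a ≤ T.card, ∏ j ∈ S, signVec T j| ≤ (d - 1).choose (a - 1) := by
  have hcancel : ∑ T : Finset (Fin d) with i ∈ T ∧ a + 1 ≤ T.card, ∏ j ∈ S, signVec T j =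
      -∑ T : Finset (Fin d) with i ∉ T ∧ a ≤ T.card, ∏ j ∈ S, signVec T j := by
    rw [← Finset.sum_neg_distrib]
    refine Finset.sum_nbij' (fun T => T.erase i) (fun T => insert i T) ?_ ?_ ?_ ?_ ?_
    · intro T hT
      have hT' := (Finset.mem_filter.mp hT).2
      simp only [Finset.mem_filter, Finset.mem_univ, true_and, Finset.notMem_erase,
        not_false_eq_true, Finset.card_erase_of_mem hT'.1]
      omega
    · intro T hT
      have hT' := (Finset.mem_filter.mp hT).2
      simp [Finset.card_insert_of_notMem hT'.1, hT'.2]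
    · intro T hT
      exact Finset.insert_erase (Finset.mem_filter.mp hT).2.1
    · intro T hT
      exact Finset.erase_insert (Finset.mem_filter.mp hT).2.1
    · intro T hT
      have h := prod_signVec_insert hS (Finset.notMem_erase i T)
      rwa [Finset.insert_erase (Finset.mem_filter.mp hT).2.1] at h
  have hsplit : ∑ T : Finset (Fin d) with a ≤ T.card, ∏ j ∈ S, signVec T j =
      ∑ T : Finset (Fin d) with i ∈ T ∧ T.card = a, ∏ j ∈ S, signVec T j := by
    have h : ∑ T : Finset (Fin d) with a ≤ T.card, ∏ j ∈ S, signVec T j =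
        ∑ T : Finset (Fin d) with i ∈ T ∧ T.card = a, ∏ j ∈ S, signVec T j +
        ∑ T : Finset (Fin d) with i ∈ T ∧ a + 1 ≤ T.card, ∏ j ∈ S, signVec T j +
        ∑ T : Finset (Fin d) with i ∉ T ∧ a ≤ T.card, ∏ j ∈ S, signVec T j := by
      simp only [Finset.sum_filter, ← Finset.sum_add_distrib]
      refine Finset.sum_congr rfl fun T _ => ?_
      rcases lt_trichotomy T.card a with h | h | h
      · simp [h.ne, not_le.mpr h, not_le.mpr (h.trans a.lt_succ_self)]
      · by_cases hi : i ∈ T <;> simp [h, hi]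
      · by_cases hi : i ∈ T <;> simp [h.ne', h.le, Nat.succ_le_of_lt h, hi]
    rw [h, hcancel]
    ring
  rw [hsplit, ← card_filter_mem_card_eq i ha]
  refine (Finset.abs_sum_le_sum_abs _ _).trans ?_
  simp [abs_prod_signVec]

lemma exists_level {d : ℕ} (hd : 5 ≤ d) :
    ∃ a, 1 ≤ a ∧ a ≤ d ∧ d ≤ 100 * (2 * a - d) ∧ 21 * ((a + 1) * a) ≤ 10 * ((d + 1) * d) := by
  by_cases h : d < 10
  · refine ⟨d / 2 + 1, ?_, ?_, ?_, ?_⟩ <;> interval_cases d <;> norm_num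
  · refine ⟨d / 2 + 1 + d / 100, by omega, by omega, by omega, ?_⟩
    have h1 : 100 * (d / 2 + 1 + d / 100) ≤ 61 * d := by omega
    generalize d / 2 + 1 + d / 100 = a at h1 ⊢
    have h2 : 100 * (a + 1) ≤ 61 * d + 100 := by omega
    have h3 := Nat.mul_le_mul h2 h1
    nlinarith

lemma choose_add_choose_le_card_upper {d : ℕ} (a : ℕ) :
    (d + 1).choose (a + 1) ≤
      (Finset.univ.filter fun T : Finset (Fin d) => a ≤ T.card).card := by
  have hdisj : Disjoint (Finset.powersetCard a (Finset.univ : Finset (Fin d)))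
      (Finset.powersetCard (a + 1) Finset.univ) :=
    Finset.pairwise_disjoint_powersetCard _ (by simp)
  have hcard := Finset.card_union_of_disjoint hdisj
  simp only [Finset.card_powersetCard, Finset.card_univ, Fintype.card_fin] at hcard
  rw [Nat.choose_succ_succ, ← hcard]
  refine Finset.card_le_card fun T hT => ?_
  simp only [Finset.mem_union, Finset.mem_powersetCard] at hT
  simp only [Finset.mem_filter, Finset.mem_univ, true_and]
  omega

/-- For dimension at least `5` there is a distribution on vectors of large mean whose nonconstant Fourier
coefficients are bounded away from `1 / 2`. -/
lemma exists_weights_of_large_parameter {d : ℕ} (hd : 5 ≤ d) :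
    ∃ f : Finset (Fin d) → ℝ, (∀ T, 0 ≤ f T) ∧ ∑ T, f T = 1 ∧
      (∀ T, f T ≠ 0 → 1 / 100 ≤ (∑ i, signVec T i) / d) ∧
      ∀ S : Finset (Fin d), S.Nonempty → |∑ T, f T * ∏ i ∈ S, signVec T i| ≤ 10 / 21 := by
  obtain ⟨a, ha1, had, hmean, hratio⟩ := exists_level hd
  set U := Finset.univ.filter fun T : Finset (Fin d) => a ≤ T.card with hU
  have hd0 : (0 : ℝ) < d := by
    have : 0 < d := by omega
    exact_mod_cast this
  have hchoose : (d + 1).choose (a + 1) ≤ U.card := choose_add_choose_le_card_upper a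
  have hcard : 0 < U.card := (Nat.choose_pos (by omega)).trans_le hchoose
  have hcard' : (0 : ℝ) < U.card := Nat.cast_pos.mpr hcard
  have hbound : 21 * (d - 1).choose (a - 1) ≤ 10 * U.card := by
    obtain ⟨b, rfl⟩ : ∃ b, a = b + 1 := ⟨a - 1, by omega⟩
    obtain ⟨e, rfl⟩ : ∃ e, d = e + 1 := ⟨d - 1, by omega⟩
    simp only [Nat.add_sub_cancel]
    have h1 := Nat.add_one_mul_choose_eq e b
    have h2 := Nat.add_one_mul_choose_eq (e + 1) (b + 1)
    refine le_of_mul_le_mul_left ?_ (by positivity : 0 < (e + 1 + 1) * (e + 1))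
    calc (e + 1 + 1) * (e + 1) * (21 * e.choose b)
        = 21 * ((e + 1 + 1) * ((e + 1) * e.choose b)) := by ring
      _ = 21 * ((b + 1 + 1) * (b + 1)) * (e + 1 + 1).choose (b + 1 + 1) := by
          rw [h1, ← mul_assoc (e + 1 + 1), h2]
          ring
      _ ≤ 10 * ((e + 1 + 1) * (e + 1)) * U.card := Nat.mul_le_mul hratio hchoose
      _ = (e + 1 + 1) * (e + 1) * (10 * U.card) := by ring
  refine ⟨fun T => if a ≤ T.card then (U.card : ℝ)⁻¹ else 0, fun T => ?_, ?_, ?_, ?_⟩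
  · dsimp only
    split_ifs
    exacts [by positivity, le_rfl]
  · rw [← Finset.sum_filter, Finset.sum_const, nsmul_eq_mul, mul_inv_cancel₀ hcard'.ne']
  · intro T hT
    have haT : a ≤ T.card := by
      by_contra h
      simp [h] at hT
    rw [sum_signVec, le_div_iff₀ hd0]
    have h1 : d + 100 * d ≤ 200 * T.card := by omega
    have h2 : (d : ℝ) + 100 * d ≤ 200 * T.card := by exact_mod_cast h1
    linarith
  · rintro S ⟨i, hi⟩
    simp_rw [ite_mul, zero_mul]
    rw [← Finset.sum_filter, ← Finset.mul_sum, abs_mul, abs_of_nonneg (by positivity),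
      inv_mul_le_iff₀ hcard']
    have h1 := abs_sum_upper_character_le (S := S) hi ha1
    have h2 : (21 : ℝ) * (d - 1).choose (a - 1) ≤ 10 * U.card := by exact_mod_cast hbound
    linarith

lemma exists_measures_of_large_parameter {d : ℕ} (hd : 5 ≤ d) :
    ∃ P1 Pm1 : Measure (Fin d → ℝ),
      IsProbabilityMeasure P1 ∧ IsProbabilityMeasure Pm1 ∧
      P1 (cube d) = 1 ∧ Pm1 (cube d) = 1 ∧
      tvDist P1 (Measure.map (fun x i => -x i) Pm1) ≤ 0 ∧
      (∀ x : Fin d → ℝ, P1 {x} ≠ 0 → 1 / 100 ≤ (∑ i, x i) / d) ∧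
      ∀ S : Finset (Fin d), |cubeFourier P1 S - cubeFourier Pm1 S| ≤ 20 / 21 := by
  obtain ⟨f, hf0, hf1, hmean, hfourier⟩ := exists_weights_of_large_parameter hd
  refine exists_measures_of_weights (g := fun T => f Tᶜ) hf0 (fun T => hf0 _) hf1
    ((sum_comp_compl f).trans hf1) (by simp) hmean fun S => ?_
  have hrefl : ∑ T, f Tᶜ * ∏ i ∈ S, signVec T i =
      (-1) ^ S.card * ∑ T, f T * ∏ i ∈ S, signVec T i := by
    rw [← sum_comp_compl, Finset.mul_sum]
    refine Finset.sum_congr rfl fun T _ => ?_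
    rw [compl_compl, prod_signVec_compl]
    ring
  rw [hrefl]
  rcases S.eq_empty_or_nonempty with rfl | hS
  · norm_num
  · have h := hfourier S hS
    refine (abs_sub _ _).trans ?_
    rw [abs_mul, abs_neg_one_pow]
    linarith
lemma sq_rpow_mul_self_eq {r γ : ℝ} (hγ : 0 < γ) :
    γ * (γ ^ (-(2 * r / 5))) ^ 2 = γ ^ (1 - r) * γ ^ (r / 5) := by
  rw [← Real.rpow_natCast, ← Real.rpow_mul hγ.le, ← Real.rpow_add hγ]
  nth_rewrite 1 [← Real.rpow_one γ]
  rw [← Real.rpow_add hγ]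
  congr 1
  push_cast
  ring

/-- The exponential error terms of the construction, expressed through a single exponential. -/
lemma error_le_of_exp_le {Λ X : ℝ} {n : ℕ} (hn : Λ < n + 1) (hX : Λ / 40000 ≤ X)
    (hsmall : Real.exp (-(1 / 80000) * Λ) ≤ 1 / 400) :
    2 * (1 / 4 : ℝ) ^ (n + 1) + 2 * Real.exp (-X) ≤ Real.exp (-(1 / 80000) * Λ) := by
  have hsq : Real.exp (-(Λ / 40000)) = Real.exp (-(1 / 80000) * Λ) ^ 2 := by
    rw [← Real.exp_nat_mul]
    congr 1
    push_cast
    ring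
  have h1 : Real.exp (-X) ≤ Real.exp (-(Λ / 40000)) := Real.exp_le_exp.mpr (by linarith)
  have h2 : (1 / 4 : ℝ) ≤ Real.exp (-1) := by
    rw [Real.exp_neg, one_div]
    exact inv_anti₀ (Real.exp_pos 1) (by linarith [Real.exp_one_lt_d9])
  have h3 : (1 / 4 : ℝ) ^ (n + 1) ≤ Real.exp (-(Λ / 40000)) := by
    calc (1 / 4 : ℝ) ^ (n + 1) ≤ Real.exp (-1) ^ (n + 1) := by gcongr
      _ = Real.exp (-(n + 1)) := by
        rw [← Real.exp_nat_mul]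
        congr 1
        push_cast
        ring
      _ ≤ Real.exp (-(Λ / 40000)) := Real.exp_le_exp.mpr (by linarith)
  rw [hsq] at h1 h3
  nlinarith [Real.exp_pos (-(1 / 80000) * Λ)]


/-- Fix `r ∈ (0,1)`, `γ ∈ (0, 2^{-1/(1-r)})`, an integer `d ≥ γ^{-2-2r/5}` and set
`η = γ^{1-r}`. Then there exist constants `C, c > 0` depending only on `r` and
probability distributions `P₁` and `P₋₁` on `{-1,1}^d` such that:
(i) `d_TV(P₁, -P₋₁) ≤ Cη`; (ii) every `x` in the support of `P₁` satisfies
`(1/d) ∑ᵢ xᵢ ≥ Cγ`; (iii) for every `S ⊆ {1,…,d}`,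
`|P̂₁(S) - P̂₋₁(S)| ≤ exp(-c γ^{-2r/5})`. -/
theorem indistinguishable_distributions (r : ℝ) (hr0 : 0 < r) (hr1 : r < 1) :
    ∃ C c : ℝ, 0 < C ∧ 0 < c ∧
      ∀ (γ : ℝ) (d : ℕ), 0 < γ → γ < (2 : ℝ) ^ (-(1 / (1 - r))) →
        γ ^ (-(2 + 2 * r / 5)) ≤ (d : ℝ) →
        ∃ P1 Pm1 : Measure (Fin d → ℝ),
          IsProbabilityMeasure P1 ∧ IsProbabilityMeasure Pm1 ∧
          P1 (cube d) = 1 ∧ Pm1 (cube d) = 1 ∧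
          tvDist P1 (Measure.map (fun x i => -x i) Pm1) ≤ C * γ ^ (1 - r) ∧
          (∀ x : Fin d → ℝ, P1 {x} ≠ 0 → C * γ ≤ (∑ i, x i) / d) ∧
          ∀ S : Finset (Fin d),
            |cubeFourier P1 S - cubeFourier Pm1 S| ≤ Real.exp (-c * γ ^ (-(2 * r / 5))) := by
  obtain ⟨γ₀, hγ₀, hγ₀1, hthreshold⟩ :=
    exists_small_threshold hr0 (1 / 80000) (by norm_num) (1 - r) (1 / 400) (by norm_num)
  refine ⟨1 / 100, min (1 / 80000) (1 / 21 * γ₀ ^ (2 * r / 5)), by norm_num, by positivity,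
    fun γ d hγ hγr hd => ?_⟩
  set Λ := γ ^ (-(2 * r / 5)) with hΛdef
  have hΛ : 0 < Λ := by positivity
  have hγhalf : γ < 1 / 2 := by
    refine hγr.trans_le ?_
    calc (2 : ℝ) ^ (-(1 / (1 - r))) ≤ 2 ^ (-1 : ℝ) := by
          refine Real.rpow_le_rpow_of_exponent_le (by norm_num) ?_
          rw [neg_le_neg_iff, le_div_iff₀ (by linarith)]
          linarith
      _ = 1 / 2 := by rw [Real.rpow_neg_one]; norm_num
  have hΛ1 : 1 ≤ Λ := Real.one_le_rpow_of_pos_of_le_one_of_nonpos hγ (by linarith) (by linarith)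
  have hdγ : Λ ≤ d * γ ^ 2 := by
    have hsplit : γ ^ (-(2 + 2 * r / 5)) * γ ^ 2 = Λ := by
      rw [← Real.rpow_natCast γ 2, ← Real.rpow_add hγ]
      congr 1
      push_cast
      ring
    rw [← hsplit]
    gcongr
  have hdpos : 0 < d := by
    rcases Nat.eq_zero_or_pos d with rfl | h
    · simp only [Nat.cast_zero, zero_mul] at hdγ
      linarith
    · exact h
  rcases lt_or_ge γ γ₀ with hlt | hge
  · obtain ⟨hpow, hexp, hexp1⟩ := hthreshold γ hγ hlt
    have hη1 : γ ^ (1 - r) ≤ 1 := Real.rpow_le_one hγ.le (by linarith) (by linarith)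
    have hη0 : 0 < γ ^ (1 - r) := by positivity
    have hfloor : (⌊Λ⌋₊ : ℝ) ≤ Λ := Nat.floor_le hΛ.le
    have hquad : 64 * (γ / 50) * (⌊Λ⌋₊ : ℝ) ^ 2 ≤ γ ^ (1 - r) / 200 := by
      calc 64 * (γ / 50) * (⌊Λ⌋₊ : ℝ) ^ 2 ≤ 64 * (γ / 50) * Λ ^ 2 := by gcongr
        _ = 64 / 50 * (γ ^ (1 - r) * γ ^ (r / 5)) := by
          rw [← sq_rpow_mul_self_eq hγ]
          ring
        _ ≤ 64 / 50 * (γ ^ (1 - r) * (1 / 400)) := by gcongr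
        _ ≤ γ ^ (1 - r) / 200 := by linarith
    have herror := error_le_of_exp_le (X := d * (γ / 50) ^ 2 / 16)
      (Nat.lt_floor_add_one Λ) (by linarith) hexp1
    have hfourth : (0 : ℝ) < (1 / 4) ^ (⌊Λ⌋₊ + 1) := by positivity
    obtain ⟨P1, Pm1, hP1, hPm1, hc1, hcm1, htv, hmean, hfourier⟩ :=
      exists_measures_of_small_parameter (n := ⌊Λ⌋₊) hdpos (s := γ / 50) (by linarith)
        (by linarith) (by linarith)
    refine ⟨P1, Pm1, hP1, hPm1, hc1, hcm1, htv.trans ?_, fun x hx => ?_, fun S => ?_⟩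
    · linarith
    · linarith [hmean x hx]
    · refine (hfourier S).trans (herror.trans (Real.exp_le_exp.mpr ?_))
      gcongr
      exact min_le_left _ _
  · have hd5 : 5 ≤ d := by
      have h4 : (4 : ℝ) < d := by nlinarith
      exact_mod_cast h4
    obtain ⟨P1, Pm1, hP1, hPm1, hc1, hcm1, htv, hmean, hfourier⟩ :=
      exists_measures_of_large_parameter hd5
    refine ⟨P1, Pm1, hP1, hPm1, hc1, hcm1, htv.trans (by positivity), fun x hx => ?_,
      fun S => ?_⟩
    · linarith [hmean x hx]
    · have hΛγ₀ : γ₀ ^ (2 * r / 5) * Λ ≤ 1 := by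
        rw [hΛdef, Real.rpow_neg hγ.le, mul_inv_le_iff₀ (by positivity), one_mul]
        gcongr
      have hcΛ : min (1 / 80000) (1 / 21 * γ₀ ^ (2 * r / 5)) * Λ ≤ 1 / 21 := by
        calc _ ≤ 1 / 21 * γ₀ ^ (2 * r / 5) * Λ := by gcongr; exact min_le_right _ _
          _ ≤ 1 / 21 := by linarith
      refine (hfourier S).trans ?_
      rw [neg_mul]
      linarith [Real.add_one_le_exp
        (-(min (1 / 80000) (1 / 21 * γ₀ ^ (2 * r / 5)) * Λ))]
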